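/- Suppose H = ℝ^N, p > 1 and α = 0. Then there exists a minimizer μ_min ∈ M_p(Z) of the problem inf_{μ ∈ KRu(Z)} F(Aμ) + G_{0,β}(μ) that can be represented as μ_min = Σ_{i=1}^N c_i (1 + d(z_i,e)^p)^{-1} δ_{z_i}, where c_i ∈ ℝ and z_i ∈ Z. -/

import Mathlib

open MeasureTheory Filter Topology
open scoped ENNReal NNReal

noncomputable section
attribute [local instance] Classical.propDecidable

variable {Z : Type*} [MetricSpace Z] [MeasurableSpace Z] [BorelSpace Z]

/-- Integral `∫ f dμ` of a function against a finite signed measure, via Jordan decomposition. -/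
def sInteg (μ : SignedMeasure Z) (f : Z → ℝ) : ℝ :=
  (∫ z, f z ∂μ.toJordanDecomposition.posPart) - ∫ z, f z ∂μ.toJordanDecomposition.negPart

/-- Total variation norm `‖μ‖_TV`. -/
def tvNorm (μ : SignedMeasure Z) : ℝ := (μ.totalVariation Set.univ).toReal

/-- The unbalanced Kantorovich–Rubinstein norm
`‖μ‖_KRu = |μ(Z)| + sup { ∫ f dμ : f(e) = 0, Lip(f) ≤ 1 }`. -/
def kruNorm (e : Z) (μ : SignedMeasure Z) : ℝ :=
  |μ Set.univ| +
    sSup {r : ℝ | ∃ f : Z → ℝ, f e = 0 ∧ LipschitzWith 1 f ∧ r = sInteg μ f}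

/-- The balanced Kantorovich–Rubinstein norm `‖μ‖_KR = sup { ∫ f dμ : f(e) = 0, Lip(f) ≤ 1 }`. -/
def krNorm (e : Z) (μ : SignedMeasure Z) : ℝ :=
  sSup {r : ℝ | ∃ f : Z → ℝ, f e = 0 ∧ LipschitzWith 1 f ∧ r = sInteg μ f}

/-- `μ ∈ M_1(Z)`: finite first moment, `∫ d(z,e) d|μ| < ∞`. -/
def MemM1 (e : Z) (μ : SignedMeasure Z) : Prop :=
  (∫⁻ z, ENNReal.ofReal (dist z e) ∂μ.totalVariation) < ⊤

/-- `μ ∈ M_p(Z)`: finite `p`-th moment, `∫ d(z,e)^p d|μ| < ∞`. -/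
def MemMp (e : Z) (p : ℝ) (μ : SignedMeasure Z) : Prop :=
  (∫⁻ z, ENNReal.ofReal (dist z e ^ p) ∂μ.totalVariation) < ⊤

/-- `∫ (1 + d(z,e)^p) d|μ|` as an extended nonnegative real number. -/
def momLint (e : Z) (p : ℝ) (μ : SignedMeasure Z) : ℝ≥0∞ :=
  ∫⁻ z, ENNReal.ofReal (1 + dist z e ^ p) ∂μ.totalVariation

/-- Dirac measure at a point, as a signed measure. -/
def diracSM (x : Z) : SignedMeasure Z := (Measure.dirac x).toSignedMeasure

/-- The regularizer `G_{α,β}(μ) = α‖μ‖_KRu + β ∫ (1 + d(z,e)^p) d|μ|` if `μ ∈ M_p(Z)`,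
and `+∞` otherwise, as an extended real number. -/
def Gab (e : Z) (p α β : ℝ) (μ : SignedMeasure Z) : EReal :=
  if MemMp e p μ then ((α * kruNorm e μ + β * (momLint e p μ).toReal : ℝ) : EReal) else ⊤

/-- A geodesic metric space: any two points are joined by points realizing all
intermediate distance proportions. -/
def IsGeodesic (Z : Type*) [MetricSpace Z] : Prop :=
  ∀ x y : Z, ∀ t : ℝ, 0 ≤ t → t ≤ 1 →
    ∃ z : Z, dist x z = t * dist x y ∧ dist z y = (1 - t) * dist x y

set_option linter.unusedSectionVars false

/-! ### Hopf-Rinow -/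

lemma aux_ball_open [LocallyCompactSpace Z] (hgeo : IsGeodesic Z) (e : Z) (r : ℝ) (hr : 0 ≤ r)
    (h : IsCompact (Metric.closedBall e r)) : ∃ δ > 0, IsCompact (Metric.closedBall e (r + δ)) := by
  obtain ⟨K, hK, hsub⟩ := exists_compact_superset h
  obtain ⟨δ, hδ, hδs⟩ := h.exists_cthickening_subset_open isOpen_interior hsub
  refine ⟨δ, hδ, hK.of_isClosed_subset Metric.isClosed_closedBall ?_⟩
  refine subset_trans ?_ (hδs.trans interior_subset)
  intro z hz
  rw [Metric.mem_closedBall'] at hz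
  have hrδ : 0 < r + δ := by linarith
  obtain ⟨w, hw1, hw2⟩ := hgeo e z (r / (r + δ)) (by positivity)
    ((div_le_one hrδ).2 (by linarith))
  have e1 : 1 - r / (r + δ) = δ / (r + δ) := by field_simp; ring
  refine Metric.mem_cthickening_of_dist_le z w δ _ ?_ ?_
  · rw [Metric.mem_closedBall', hw1]
    calc r / (r + δ) * dist e z ≤ r / (r + δ) * (r + δ) := by gcongr
      _ = r := by field_simp
  · rw [dist_comm, hw2, e1]
    calc δ / (r + δ) * dist e z ≤ δ / (r + δ) * (r + δ) := by gcongr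
      _ = δ := by field_simp

lemma aux_ball_closed [CompleteSpace Z] (hgeo : IsGeodesic Z) (e : Z) (r : ℝ) (hr : 0 < r)
    (h : ∀ s, 0 ≤ s → s < r → IsCompact (Metric.closedBall e s)) :
    IsCompact (Metric.closedBall e r) := by
  refine TotallyBounded.isCompact_of_isClosed ?_ Metric.isClosed_closedBall
  rw [Metric.totallyBounded_iff]
  intro ε hε
  set η := min (ε / 2) r with hη
  have hη0 : 0 < η := lt_min (by linarith) hr
  have hηr : η ≤ r := min_le_right _ _
  have hηε : η ≤ ε / 2 := min_le_left _ _
  obtain ⟨t, ht, hcov⟩ := Metric.totallyBounded_iff.1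
    (h (r - η) (by linarith) (by linarith)).totallyBounded (ε / 2) (by linarith)
  refine ⟨t, ht, ?_⟩
  intro z hz
  rw [Metric.mem_closedBall'] at hz
  obtain ⟨w, hw1, hw2⟩ := hgeo e z ((r - η) / r) (div_nonneg (by linarith) hr.le)
    ((div_le_one hr).2 (by linarith))
  have e1 : 1 - (r - η) / r = η / r := by field_simp; ring
  have hw : w ∈ Metric.closedBall e (r - η) := by
    rw [Metric.mem_closedBall', hw1]
    calc (r - η) / r * dist e z ≤ (r - η) / r * r := by
          gcongr
      _ = r - η := by field_simp
  have hwz : dist w z ≤ η := by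
    rw [hw2, e1]
    calc η / r * dist e z ≤ η / r * r := by gcongr
      _ = η := by field_simp
  have := hcov hw
  simp only [Set.mem_iUnion, Metric.mem_ball, exists_prop] at this ⊢
  obtain ⟨y, hy, hyw⟩ := this
  refine ⟨y, hy, ?_⟩
  have := dist_triangle z w y
  rw [dist_comm z w] at this
  linarith

lemma aux_proper [LocallyCompactSpace Z] [CompleteSpace Z] (hgeo : IsGeodesic Z) : ProperSpace Z := by
  refine ⟨fun e r => ?_⟩
  by_contra hcon
  have hmono : ∀ s t, s ≤ t → IsCompact (Metric.closedBall e t) →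
      IsCompact (Metric.closedBall e s) := fun s t hst ht =>
    ht.of_isClosed_subset Metric.isClosed_closedBall (Metric.closedBall_subset_closedBall hst)
  set I := {s : ℝ | 0 ≤ s ∧ IsCompact (Metric.closedBall e s)} with hI
  have h0 : (0 : ℝ) ∈ I := ⟨le_rfl, by simp⟩
  have hbdd : BddAbove I := ⟨r, fun s hs => by
    by_contra hlt
    exact hcon (hmono r s (not_le.1 hlt).le hs.2)⟩
  set R := sSup I with hR
  have hR0 : 0 ≤ R := le_csSup hbdd h0
  have hRI : IsCompact (Metric.closedBall e R) := by
    rcases hR0.eq_or_lt with h | h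
    · rw [← h]; exact h0.2
    · refine aux_ball_closed hgeo e R h fun s hs hsR => ?_
      obtain ⟨t, ht, hst⟩ := exists_lt_of_lt_csSup ⟨0, h0⟩ hsR
      exact hmono s t hst.le ht.2
  obtain ⟨δ, hδ, hc⟩ := aux_ball_open hgeo e R hR0 hRI
  have : R + δ ≤ R := le_csSup hbdd ⟨by linarith, hc⟩
  linarith

/-! ### Conic Caratheodory -/

section Conic
variable {E : Type*} [NormedAddCommGroup E] [NormedSpace ℝ E] [FiniteDimensional ℝ E]

lemma aux_step (S : Set E) (n : ℕ) (hn : Module.finrank ℝ E ≤ n) (c : Fin (n + 1) → ℝ)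
    (v : Fin (n + 1) → E) (hc : ∀ i, 0 ≤ c i) (hv : ∀ i, v i ∈ S) :
    ∃ (c' : Fin n → ℝ) (v' : Fin n → E), (∀ i, 0 ≤ c' i) ∧ (∀ i, v' i ∈ S) ∧
      ∑ i, c' i ≤ ∑ i, c i ∧ ∑ i, c' i • v' i = ∑ i, c i • v i := by
  have hdep : ¬ LinearIndependent ℝ v := by
    intro h
    have := h.fintype_card_le_finrank
    simp at this
    omega
  rw [Fintype.not_linearIndependent_iff] at hdep
  have hdep' : ∃ g : Fin (n + 1) → ℝ, ∑ i, g i • v i = 0 ∧ 0 ≤ ∑ i, g i ∧ ∃ i, 0 < g i := by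
    obtain ⟨g, hg, i, hi⟩ := hdep
    have key : ∀ g : Fin (n + 1) → ℝ, (∃ i, g i ≠ 0) → 0 ≤ ∑ i, g i → ∃ i, 0 < g i := by
      intro g ⟨i, hi⟩ hs
      by_contra! hcon
      have h1 : ∑ i, g i = 0 := le_antisymm (Finset.sum_nonpos fun i _ => hcon i) hs
      exact hi ((Finset.sum_eq_zero_iff_of_nonpos fun i _ => hcon i).1 h1 i (Finset.mem_univ _))
    rcases le_total 0 (∑ i, g i) with h | h
    · exact ⟨g, hg, h, key g ⟨i, hi⟩ h⟩
    · have h' : 0 ≤ ∑ i, (-g) i := by simpa using h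
      exact ⟨-g, by simp [hg], h', key (-g) ⟨i, by simpa using hi⟩ h'⟩
  obtain ⟨g, hg, hgs, i0, hi0⟩ := hdep'
  obtain ⟨j, hj, hjmin⟩ := Finset.exists_min_image (Finset.univ.filter fun i => 0 < g i)
    (fun i => c i / g i) ⟨i0, by simpa using hi0⟩
  simp only [Finset.mem_filter, Finset.mem_univ, true_and] at hj hjmin
  set s := c j / g j with hs
  have hs0 : 0 ≤ s := div_nonneg (hc j) hj.le
  have hnn : ∀ i, 0 ≤ c i - s * g i := by
    intro i
    rcases le_or_gt (g i) 0 with h | h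
    · nlinarith [hc i, mul_nonneg hs0 (neg_nonneg.2 h)]
    · have := hjmin i h
      rw [le_div_iff₀ h] at this
      linarith
  have hj0 : c j - s * g j = 0 := by rw [hs]; field_simp; ring
  refine ⟨fun i => c (j.succAbove i) - s * g (j.succAbove i), fun i => v (j.succAbove i),
    fun i => hnn _, fun i => hv _, ?_, ?_⟩
  · have h1 := Fin.sum_univ_succAbove (fun i => c i - s * g i) j
    simp only [hj0, zero_add] at h1
    rw [← h1, Finset.sum_sub_distrib, ← Finset.mul_sum]
    nlinarith [mul_nonneg hs0 hgs]
  · have h1 := Fin.sum_univ_succAbove (fun i => (c i - s * g i) • v i) j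
    simp only [hj0, zero_add, zero_smul] at h1
    rw [← h1]
    simp only [sub_smul, Finset.sum_sub_distrib, mul_smul, ← Finset.smul_sum, hg, smul_zero, sub_zero]

lemma aux_reduce (S : Set E) (hS : S.Nonempty) (N : ℕ) (hN : Module.finrank ℝ E = N) (n : ℕ) :
    ∀ (c : Fin n → ℝ) (v : Fin n → E), (∀ i, 0 ≤ c i) → (∀ i, v i ∈ S) →
    ∃ (c' : Fin N → ℝ) (v' : Fin N → E), (∀ i, 0 ≤ c' i) ∧ (∀ i, v' i ∈ S) ∧
      ∑ i, c' i ≤ ∑ i, c i ∧ ∑ i, c' i • v' i = ∑ i, c i • v i := by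
  rcases le_total n N with h | h
  · obtain ⟨k, rfl⟩ := Nat.exists_eq_add_of_le h
    obtain ⟨s, hs⟩ := hS
    intro c v hc hv
    refine ⟨Fin.append c 0, Fin.append v (fun _ => s), ?_, ?_, ?_, ?_⟩
    · intro i
      refine Fin.addCases (fun i => ?_) (fun i => ?_) i <;> simp [hc]
    · intro i
      refine Fin.addCases (fun i => ?_) (fun i => ?_) i <;> simp [hv, hs]
    · simp [Fin.sum_univ_add]
    · simp [Fin.sum_univ_add]
  · induction n, h using Nat.le_induction with
    | base => exact fun c v hc hv => ⟨c, v, hc, hv, le_rfl, rfl⟩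
    | succ n hn ih =>
      intro c v hc hv
      obtain ⟨c1, v1, h1, h2, h3, h4⟩ := aux_step S n (hN ▸ hn) c v hc hv
      obtain ⟨c2, v2, k1, k2, k3, k4⟩ := ih c1 v1 h1 h2
      exact ⟨c2, v2, k1, k2, k3.trans h3, k4.trans h4⟩

/-- Conic combinations of `N` elements of `S` with total weight at most one. -/
def auxQ (S : Set E) (N : ℕ) : Set E :=
  {x | ∃ (c : Fin N → ℝ) (v : Fin N → E), (∀ i, 0 ≤ c i) ∧ (∀ i, v i ∈ S) ∧
      ∑ i, c i ≤ 1 ∧ ∑ i, c i • v i = x}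

lemma auxQ_convex (S : Set E) (hS : S.Nonempty) (N : ℕ) (hN : Module.finrank ℝ E = N) :
    Convex ℝ (auxQ S N) := by
  rintro x ⟨c, v, h1, h2, h3, rfl⟩ y ⟨c', v', h1', h2', h3', rfl⟩ a b ha hb hab
  obtain ⟨c2, v2, k1, k2, k3, k4⟩ := aux_reduce S hS N hN (N + N)
    (Fin.append (fun i => a * c i) (fun i => b * c' i)) (Fin.append v v')
    (by
      intro i
      refine Fin.addCases (fun i => ?_) (fun i => ?_) i
      · simpa using mul_nonneg ha (h1 i)
      · rw [Fin.append_right]; exact mul_nonneg hb (h1' i))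
    (by
      intro i
      refine Fin.addCases (fun i => ?_) (fun i => ?_) i
      · rw [Fin.append_left]; exact h2 i
      · rw [Fin.append_right]; exact h2' i)
  refine ⟨c2, v2, k1, k2, k3.trans ?_, k4.trans ?_⟩
  · simp only [Fin.sum_univ_add, Fin.append_left, Fin.append_right, ← Finset.mul_sum]
    nlinarith
  · simp only [Fin.sum_univ_add, Fin.append_left, Fin.append_right, mul_smul, ← Finset.smul_sum]

lemma auxQ_closed (S : Set E) (hS : IsCompact S) (N : ℕ) : IsClosed (auxQ S N) := by
  have hc1 : IsCompact {c : Fin N → ℝ | (∀ i, 0 ≤ c i) ∧ ∑ i, c i ≤ 1} := by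
    refine (isCompact_univ_pi (fun _ : Fin N => isCompact_Icc (a := (0 : ℝ)) (b := 1))).of_isClosed_subset
      ?_ ?_
    · have heq : {c : Fin N → ℝ | (∀ i, 0 ≤ c i) ∧ ∑ i, c i ≤ 1} =
          (⋂ i, {c : Fin N → ℝ | 0 ≤ c i}) ∩ {c : Fin N → ℝ | ∑ i, c i ≤ 1} := by
        ext c; simp
      rw [heq]
      refine IsClosed.inter ?_ ?_
      · exact isClosed_iInter fun i => isClosed_le continuous_const (continuous_apply i)
      · exact isClosed_le (by fun_prop) continuous_const
    · intro c hc i _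
      exact ⟨hc.1 i, (Finset.single_le_sum (fun j _ => hc.1 j) (Finset.mem_univ i)).trans hc.2⟩
  have hc2 := hc1.prod (isCompact_univ_pi (fun _ : Fin N => hS))
  have hcont : Continuous fun q : (Fin N → ℝ) × (Fin N → E) => ∑ i, q.1 i • q.2 i := by fun_prop
  have := (hc2.image hcont).isClosed
  convert this using 1
  ext x
  constructor
  · rintro ⟨c, v, h1, h2, h3, h4⟩
    exact ⟨(c, v), ⟨⟨h1, h3⟩, fun i _ => h2 i⟩, h4⟩
  · rintro ⟨⟨c, v⟩, ⟨⟨h1, h3⟩, h2⟩, h4⟩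
    exact ⟨c, v, h1, fun i => h2 i trivial, h3, h4⟩

lemma auxQ_mem (S : Set E) (hS : S.Nonempty) (N : ℕ) (hN : Module.finrank ℝ E = N) (x : E)
    (hx : x ∈ S) : x ∈ auxQ S N := by
  obtain ⟨c2, v2, k1, k2, k3, k4⟩ := aux_reduce S hS N hN 1 (fun _ => 1) (fun _ => x)
    (by simp) (by simpa using hx)
  exact ⟨c2, v2, k1, k2, by simpa using k3, by simpa using k4⟩

end Conic

/-! ### Measures -/

lemma aux_tv_sub (α β : Measure Z) [IsFiniteMeasure α] [IsFiniteMeasure β] :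
    (α.toSignedMeasure - β.toSignedMeasure).totalVariation ≤ α + β := by
  rw [SignedMeasure.totalVariation_eq_variation]
  refine VectorMeasure.variation_sub_le.trans ?_
  simp

lemma aux_sInteg (α β : Measure Z) [IsFiniteMeasure α] [IsFiniteMeasure β] (f : Z → ℝ)
    (hα : Integrable f α) (hβ : Integrable f β) :
    sInteg (α.toSignedMeasure - β.toSignedMeasure) f = ∫ z, f z ∂α - ∫ z, f z ∂β := by
  unfold sInteg
  rw [Measure.toJordanDecomposition_toSignedMeasure_sub,
    Measure.jordanDecompositionOfToSignedMeasureSub_posPart,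
    Measure.jordanDecompositionOfToSignedMeasureSub_negPart]
  have h1 : (α - β).toSignedMeasure - (β - α).toSignedMeasure
      = α.toSignedMeasure - β.toSignedMeasure := by
    exact Measure.jordanDecompositionOfToSignedMeasureSub_toSignedMeasure (μ := α) (ν := β)
  have h2 : (α - β) + β = α + (β - α) := by
    rw [← Measure.toSignedMeasure_eq_toSignedMeasure_iff, Measure.toSignedMeasure_add,
      Measure.toSignedMeasure_add]
    rw [sub_eq_sub_iff_add_eq_add] at h1
    exact h1
  have i1 : Integrable f (α - β) := hα.mono_measure Measure.sub_le
  have i2 : Integrable f (β - α) := hβ.mono_measure Measure.sub_le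
  have h3 := integral_add_measure i1 hβ
  have h4 := integral_add_measure hα i2
  rw [h2] at h3
  linarith

lemma aux_lip_int (e : Z) (α : Measure Z) [IsFiniteMeasure α]
    (hα : Integrable (fun z => dist z e) α) (f : Z → ℝ) (hf : LipschitzWith 1 f) (hfe : f e = 0) :
    Integrable f α := by
  refine hα.mono' hf.continuous.measurable.aestronglyMeasurable (ae_of_all _ fun z => ?_)
  have := hf.dist_le_mul z e
  rw [hfe, dist_zero_right] at this
  simpa using this

lemma aux_kru_nonneg (e : Z) (μ : SignedMeasure Z) : 0 ≤ kruNorm e μ := by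
  unfold kruNorm
  refine add_nonneg (abs_nonneg _) (Real.sSup_nonneg' ⟨0, ⟨fun _ => 0, rfl, ?_, ?_⟩, le_rfl⟩)
  · exact LipschitzWith.const' 0
  · simp [sInteg]

lemma aux_A_bound {E : Type*} [NormedAddCommGroup E] [NormedSpace ℝ E] (e : Z)
    (A : SignedMeasure Z → E) (C : ℝ)
    (hAbdd : ∀ μ : SignedMeasure Z, MemM1 e μ → ‖A μ‖ ≤ C * kruNorm e μ)
    (α β : Measure Z) [IsFiniteMeasure α] [IsFiniteMeasure β]
    (hα : Integrable (fun z => dist z e) α) (hβ : Integrable (fun z => dist z e) β)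
    (hm : α.real Set.univ = β.real Set.univ) (B : ℝ)
    (hB : ∀ f : Z → ℝ, f e = 0 → LipschitzWith 1 f → ∫ z, f z ∂α - ∫ z, f z ∂β ≤ B) :
    ‖A (α.toSignedMeasure - β.toSignedMeasure)‖ ≤ |C| * B := by
  have hM1 : MemM1 e (α.toSignedMeasure - β.toSignedMeasure) := by
    unfold MemM1
    refine (lintegral_mono' (aux_tv_sub α β) le_rfl).trans_lt ?_
    rw [lintegral_add_measure]
    have h1 := hα.lintegral_lt_top
    have h2 := hβ.lintegral_lt_top
    exact ENNReal.add_lt_top.2 ⟨h1, h2⟩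
  have hk : kruNorm e (α.toSignedMeasure - β.toSignedMeasure) ≤ B := by
    unfold kruNorm
    rw [Measure.toSignedMeasure_sub_apply MeasurableSet.univ, hm, sub_self, abs_zero, zero_add]
    refine csSup_le ⟨0, fun _ => 0, rfl, LipschitzWith.const' 0, by simp [sInteg]⟩ ?_
    rintro r ⟨f, hfe, hf, rfl⟩
    rw [aux_sInteg α β f (aux_lip_int e α hα f hf hfe) (aux_lip_int e β hβ f hf hfe)]
    exact hB f hfe hf
  calc _ ≤ C * kruNorm e (α.toSignedMeasure - β.toSignedMeasure) := hAbdd _ hM1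
    _ ≤ |C| * kruNorm e (α.toSignedMeasure - β.toSignedMeasure) := by
        gcongr
        · exact aux_kru_nonneg _ _
        · exact le_abs_self C
    _ ≤ |C| * B := by gcongr

lemma aux_simple_int {E : Type*} [NormedAddCommGroup E] [NormedSpace ℝ E] [CompleteSpace E]
    (α : Measure Z) [IsFiniteMeasure α] (s : SimpleFunc Z Z) (g : Z → E) :
    ∫ z, g (s z) ∂α = ∑ y ∈ s.range, α.real (s ⁻¹' {y}) • g y := by
  have h1 : ∀ z, g (s z) = ∑ y ∈ s.range, (s ⁻¹' {y}).indicator (fun _ => g y) z := by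
    intro z
    rw [Finset.sum_eq_single (s z)]
    · simp
    · intro y _ hy
      simp [Set.indicator, hy.symm]
    · intro h
      exact absurd (s.mem_range_self z) h
  simp_rw [h1]
  rw [integral_finsetSum]
  · refine Finset.sum_congr rfl fun y _ => ?_
    rw [integral_indicator_const _ (s.measurableSet_preimage _)]
  · intro y _
    exact (integrable_const _).indicator (s.measurableSet_preimage _)

lemma aux_map_simple (α : Measure Z) [IsFiniteMeasure α] (s : SimpleFunc Z Z) :
    (α.map s).toSignedMeasure = ∑ y ∈ s.range, α.real (s ⁻¹' {y}) • diracSM y := by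
  ext B hB
  rw [Measure.toSignedMeasure_apply_measurable hB]
  have h1 := aux_simple_int α s (B.indicator (fun _ => (1 : ℝ)))
  have h2 : ∫ z, B.indicator (fun _ => (1 : ℝ)) (s z) ∂α = (α.map s).real B := by
    rw [← integral_map s.measurable.aemeasurable
      (measurable_const.indicator hB).aestronglyMeasurable, integral_indicator_const _ hB]
    simp
  rw [← h2, h1, FunLike.coe_sum, Finset.sum_apply]
  refine Finset.sum_congr rfl fun y _ => ?_
  rw [smul_apply, diracSM, Measure.toSignedMeasure_apply_measurable hB]
  simp [Measure.real, Measure.dirac_apply' _ hB, Set.indicator]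
  split_ifs <;> simp

lemma aux_dirac_lip {E : Type*} [NormedAddCommGroup E] [NormedSpace ℝ E] (e : Z)
    (A : SignedMeasure Z → E) (C : ℝ)
    (hAsub : ∀ μ ν : SignedMeasure Z, A (μ - ν) = A μ - A ν)
    (hAbdd : ∀ μ : SignedMeasure Z, MemM1 e μ → ‖A μ‖ ≤ C * kruNorm e μ) (x y : Z) :
    ‖A (diracSM x) - A (diracSM y)‖ ≤ |C| * dist x y := by
  rw [← hAsub]
  have hi : ∀ w : Z, Integrable (fun z => dist z e) (Measure.dirac w) := fun w =>
    (integrable_dirac (by simp))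
  refine aux_A_bound e A C hAbdd _ _ (hi x) (hi y) (by simp) _ ?_
  intro f _ hf
  rw [integral_dirac, integral_dirac]
  have := hf.dist_le_mul x y
  rw [Real.dist_eq] at this
  have h2 := le_abs_self (f x - f y)
  simp at this
  linarith

lemma aux_repr [TopologicalSpace.SeparableSpace Z]
    {E : Type*} [NormedAddCommGroup E] [NormedSpace ℝ E] [CompleteSpace E] (e : Z)
    (A : SignedMeasure Z → E) (C : ℝ)
    (hAadd : ∀ μ ν : SignedMeasure Z, A (μ + ν) = A μ + A ν)
    (hAsmul : ∀ (c : ℝ) (μ : SignedMeasure Z), A (c • μ) = c • A μ)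
    (hAbdd : ∀ μ : SignedMeasure Z, MemM1 e μ → ‖A μ‖ ≤ C * kruNorm e μ)
    (α : Measure Z) [IsFiniteMeasure α] (hα : Integrable (fun z => dist z e) α) :
    Integrable (fun z => A (diracSM z)) α ∧ A α.toSignedMeasure = ∫ z, A (diracSM z) ∂α := by
  have : SecondCountableTopology Z := UniformSpace.secondCountable_of_separable Z
  let L : SignedMeasure Z →ₗ[ℝ] E := ⟨⟨A, hAadd⟩, hAsmul⟩
  have hAsub : ∀ μ ν : SignedMeasure Z, A (μ - ν) = A μ - A ν := fun μ ν => L.map_sub μ ν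
  have hlip := aux_dirac_lip e A C hAsub hAbdd
  have hLip : LipschitzWith (Real.toNNReal |C|) (fun z => A (diracSM z)) := by
    refine LipschitzWith.of_dist_le_mul fun x y => ?_
    rw [dist_eq_norm, Real.coe_toNNReal _ (abs_nonneg C)]
    exact hlip x y
  have hgrow : ∀ z, ‖A (diracSM z)‖ ≤ ‖A (diracSM e)‖ + |C| * dist z e := by
    intro z
    have := norm_le_insert' (A (diracSM z)) (A (diracSM e))
    linarith [hlip z e]
  have hsm : ∀ ν : Measure Z, AEStronglyMeasurable (fun z => A (diracSM z)) ν := fun ν =>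
    hLip.continuous.stronglyMeasurable.aestronglyMeasurable
  have hhI : Integrable (fun z => A (diracSM z)) α :=
    ((integrable_const _).add (hα.const_mul |C|)).mono' (hsm α) (ae_of_all _ hgrow)
  refine ⟨hhI, ?_⟩
  let s : ℕ → SimpleFunc Z Z := fun n =>
    SimpleFunc.approxOn (id : Z → Z) measurable_id Set.univ e trivial n
  have hs1 : ∀ n z, dist (s n z) z ≤ dist z e := by
    intro n z
    have := SimpleFunc.edist_approxOn_le (f := (id : Z → Z)) measurable_id (s := Set.univ)
      (y₀ := e) trivial z n
    rw [edist_dist, edist_dist, ENNReal.ofReal_le_ofReal_iff dist_nonneg, dist_comm e] at this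
    exact this
  have hs2 : ∀ z, Tendsto (fun n => s n z) atTop (𝓝 z) := fun z =>
    SimpleFunc.tendsto_approxOn (f := (id : Z → Z)) measurable_id (Set.mem_univ e) (by simp)
  have hmd : ∀ n, Measurable fun z => dist (s n z) z := fun n =>
    (s n).measurable.dist measurable_id
  have hid : ∀ n, Integrable (fun z => dist (s n z) z) α := fun n =>
    hα.mono' (hmd n).aestronglyMeasurable (ae_of_all _ fun z => by
      rw [Real.norm_of_nonneg dist_nonneg]; exact hs1 n z)
  have hlim : Tendsto (fun n => ∫ z, dist (s n z) z ∂α) atTop (𝓝 0) := by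
    have := tendsto_integral_of_dominated_convergence (μ := α) (F := fun n z => dist (s n z) z)
      (f := fun _ => (0 : ℝ)) (fun z => dist z e) (fun n => (hmd n).aestronglyMeasurable) hα
      (fun n => ae_of_all _ fun z => by
        rw [Real.norm_of_nonneg dist_nonneg]; exact hs1 n z)
      (ae_of_all _ fun z => by
        have := (hs2 z).dist (tendsto_const_nhds (x := z))
        simpa using this)
    simpa using this
  have hse : ∀ n, Integrable (fun z => dist (s n z) e) α := fun n => by
    refine (hα.add (hid n)).mono' ((s n).measurable.dist measurable_const).aestronglyMeasurable
      (ae_of_all _ fun z => ?_)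
    rw [Real.norm_of_nonneg dist_nonneg]
    have := dist_triangle (s n z) z e
    simp only [Pi.add_apply]
    linarith
  have hmapI : ∀ n, Integrable (fun z => dist z e) (α.map (s n)) := fun n => by
    rw [integrable_map_measure (by fun_prop) (s n).measurable.aemeasurable]
    exact hse n
  have hAn : ∀ n, A (α.map (s n)).toSignedMeasure = ∫ z, A (diracSM (s n z)) ∂α := by
    intro n
    rw [aux_map_simple, aux_simple_int α (s n) (fun y => A (diracSM y))]
    change L _ = _
    rw [map_sum]
    refine Finset.sum_congr rfl fun y _ => ?_
    exact hAsmul _ _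
  have hhI_n : ∀ n, Integrable (fun z => A (diracSM (s n z))) α := fun n =>
    ((integrable_const _).add ((hse n).const_mul |C|)).mono'
      ((s n).map (fun y => A (diracSM y))).aestronglyMeasurable (ae_of_all _ fun z => hgrow _)
  have b1 : ∀ n, ‖A α.toSignedMeasure - A (α.map (s n)).toSignedMeasure‖
      ≤ |C| * ∫ z, dist (s n z) z ∂α := by
    intro n
    rw [← hAsub]
    refine aux_A_bound e A C hAbdd _ _ hα (hmapI n) ?_ _ ?_
    · rw [map_measureReal_apply (s n).measurable MeasurableSet.univ]; simp
    · intro f hfe hf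
      have i1 := aux_lip_int e α hα f hf hfe
      have i2 := aux_lip_int e _ (hmapI n) f hf hfe
      have i3 : Integrable (fun z => f (s n z)) α :=
        (integrable_map_measure i2.aestronglyMeasurable (s n).measurable.aemeasurable).1 i2
      rw [integral_map (s n).measurable.aemeasurable i2.aestronglyMeasurable, ← integral_sub i1 i3]
      refine integral_mono (i1.sub i3) (hid n) fun z => ?_
      have := hf.dist_le_mul z (s n z)
      rw [Real.dist_eq] at this
      have h2 := le_abs_self (f z - f (s n z))
      rw [dist_comm z] at this
      simp at this ⊢
      linarith
  have b2 : ∀ n, ‖A (α.map (s n)).toSignedMeasure - ∫ z, A (diracSM z) ∂α‖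
      ≤ |C| * ∫ z, dist (s n z) z ∂α := by
    intro n
    rw [hAn, ← integral_sub (hhI_n n) hhI, ← integral_const_mul]
    exact norm_integral_le_of_norm_le ((hid n).const_mul _) (ae_of_all _ fun z => hlip _ _)
  have b3 : ∀ n, ‖A α.toSignedMeasure - ∫ z, A (diracSM z) ∂α‖
      ≤ 2 * |C| * ∫ z, dist (s n z) z ∂α := by
    intro n
    have := norm_sub_le_norm_sub_add_norm_sub (A α.toSignedMeasure)
      (A (α.map (s n)).toSignedMeasure) (∫ z, A (diracSM z) ∂α)
    linarith [b1 n, b2 n]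
  have := ge_of_tendsto' (hlim.const_mul (2 * |C|)) b3
  rw [mul_zero] at this
  exact sub_eq_zero.1 (norm_le_zero_iff.1 this)

lemma aux_w_pos (e : Z) (p : ℝ) (z : Z) : 0 < 1 + dist z e ^ p := by
  have := Real.rpow_nonneg (dist_nonneg (x := z) (y := e)) p
  linarith

lemma aux_w_meas (e : Z) (p : ℝ) : Measurable fun z : Z => 1 + dist z e ^ p := by
  have h : Continuous fun z : Z => dist z e := by fun_prop
  exact measurable_const.add (h.measurable.pow_const p)

lemma aux_dist_le_w (e : Z) (p : ℝ) (hp : 1 < p) (z : Z) : dist z e ≤ 1 + dist z e ^ p := by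
  have := Real.rpow_nonneg (dist_nonneg (x := z) (y := e)) p
  rcases le_total (dist z e) 1 with h | h
  · linarith
  · have := Real.self_le_rpow_of_one_le h hp.le
    linarith

lemma aux_w_int (e : Z) (p : ℝ) (μ : SignedMeasure Z) (h : MemMp e p μ) :
    Integrable (fun z => 1 + dist z e ^ p) μ.totalVariation := by
  have : IsFiniteMeasure μ.totalVariation := by
    unfold SignedMeasure.totalVariation; infer_instance
  refine (integrable_const _).add ?_
  have hm : Continuous fun z : Z => dist z e := by fun_prop
  rw [← lintegral_ofReal_ne_top_iff_integrable (hm.measurable.pow_const p).aestronglyMeasurable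
    (ae_of_all _ fun z => Real.rpow_nonneg dist_nonneg p)]
  exact h.ne

lemma aux_pos_measure {E : Type*} [NormedAddCommGroup E] [NormedSpace ℝ E] [CompleteSpace E]
    (Q : Set E) (hQc : IsClosed Q) (hQ : Convex ℝ Q) (hQ0 : (0 : E) ∈ Q) (α : Measure Z)
    [IsFiniteMeasure α] (w : Z → ℝ) (hw : ∀ z, 0 < w z) (hwm : Measurable w)
    (hwi : Integrable w α) (φ : Z → E) (hφi : Integrable φ α)
    (hφ : ∀ z, (w z)⁻¹ • φ z ∈ Q) : ∃ q ∈ Q, ∫ z, φ z ∂α = (∫ z, w z ∂α) • q := by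
  set ν := α.withDensity (fun z => ENNReal.ofReal (w z)) with hν
  have hfin : IsFiniteMeasure ν := isFiniteMeasure_withDensity_ofReal hwi.2
  have hmass : ν.real Set.univ = ∫ z, w z ∂α := by
    rw [Measure.real, hν, withDensity_apply _ MeasurableSet.univ, Measure.restrict_univ,
      ← ofReal_integral_eq_lintegral_ofReal hwi (ae_of_all _ fun z => (hw z).le),
      ENNReal.toReal_ofReal (integral_nonneg fun z => (hw z).le)]
  have hfun : ∀ z, (ENNReal.ofReal (w z)).toReal • ((w z)⁻¹ • φ z) = φ z := by
    intro z
    rw [ENNReal.toReal_ofReal (hw z).le, smul_smul, mul_inv_cancel₀ (hw z).ne', one_smul]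
  have hhI : ∫ z, (w z)⁻¹ • φ z ∂ν = ∫ z, φ z ∂α := by
    rw [hν, integral_withDensity_eq_integral_toReal_smul hwm.ennreal_ofReal
      (ae_of_all _ fun z => ENNReal.ofReal_lt_top)]
    simp_rw [hfun]
  have hhIi : Integrable (fun z => (w z)⁻¹ • φ z) ν := by
    rw [hν, integrable_withDensity_iff_integrable_smul' hwm.ennreal_ofReal
      (ae_of_all _ fun z => ENNReal.ofReal_lt_top)]
    simp_rw [hfun]
    exact hφi
  by_cases h0 : ν = 0
  · refine ⟨0, hQ0, ?_⟩
    rw [← hhI, h0]; simp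
  · have : NeZero ν := ⟨h0⟩
    refine ⟨⨍ z, (w z)⁻¹ • φ z ∂ν, hQ.average_mem hQc (ae_of_all _ hφ) hhIi, ?_⟩
    rw [← hmass, measure_smul_average, hhI]

lemma aux_decomp [TopologicalSpace.SeparableSpace Z]
    {E : Type*} [NormedAddCommGroup E] [NormedSpace ℝ E] [FiniteDimensional ℝ E] (N : ℕ)
    (hN : Module.finrank ℝ E = N) (e : Z) (p : ℝ) (hp : 1 < p)
    (A : SignedMeasure Z → E) (C : ℝ)
    (hAadd : ∀ μ ν : SignedMeasure Z, A (μ + ν) = A μ + A ν)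
    (hAsmul : ∀ (c : ℝ) (μ : SignedMeasure Z), A (c • μ) = c • A μ)
    (hAbdd : ∀ μ : SignedMeasure Z, MemM1 e μ → ‖A μ‖ ≤ C * kruNorm e μ)
    (S : Set E) (hSc : IsCompact S) (hS0 : (0 : E) ∈ S) (hSn : ∀ x ∈ S, -x ∈ S)
    (hSψ : ∀ z, (1 + dist z e ^ p)⁻¹ • A (diracSM z) ∈ S)
    (μ : SignedMeasure Z) (hμ : MemMp e p μ) :
    ∃ (c : Fin N → ℝ) (v : Fin N → E), (∀ i, 0 ≤ c i) ∧ (∀ i, v i ∈ S) ∧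
      ∑ i, c i ≤ (momLint e p μ).toReal ∧ ∑ i, c i • v i = A μ := by
  have : CompleteSpace E := FiniteDimensional.complete ℝ E
  have hne : S.Nonempty := ⟨0, hS0⟩
  have hQc := auxQ_closed S hSc N
  have hQ := auxQ_convex S hne N hN
  have hQS := auxQ_mem S hne N hN
  have hQn : ∀ x ∈ auxQ S N, -x ∈ auxQ S N := by
    rintro x ⟨c, v, h1, h2, h3, rfl⟩
    exact ⟨c, fun i => - v i, h1, fun i => hSn _ (h2 i), h3, by simp⟩
  set P := μ.toJordanDecomposition.posPart with hP
  set M := μ.toJordanDecomposition.negPart with hM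
  have hwi := aux_w_int e p μ hμ
  have hwP : Integrable (fun z => 1 + dist z e ^ p) P := hwi.mono_measure (Measure.le_add_right le_rfl)
  have hwM : Integrable (fun z => 1 + dist z e ^ p) M := hwi.mono_measure (Measure.le_add_left le_rfl)
  have hmom : (momLint e p μ).toReal
      = ∫ z, (1 + dist z e ^ p) ∂P + ∫ z, (1 + dist z e ^ p) ∂M := by
    rw [← integral_add_measure hwP hwM, momLint,
      ← ofReal_integral_eq_lintegral_ofReal hwi (ae_of_all _ fun z => (aux_w_pos e p z).le),
      ENNReal.toReal_ofReal (integral_nonneg fun z => (aux_w_pos e p z).le)]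
    rfl
  have hdm : Measurable fun z : Z => dist z e := by
    have h : Continuous fun z : Z => dist z e := by fun_prop
    exact h.measurable
  have hd : ∀ α : Measure Z, Integrable (fun z => 1 + dist z e ^ p) α →
      Integrable (fun z => dist z e) α := fun α h =>
    h.mono' hdm.aestronglyMeasurable (ae_of_all _ fun z => by
      rw [Real.norm_of_nonneg dist_nonneg]; exact aux_dist_le_w e p hp z)
  obtain ⟨iP, rP⟩ := aux_repr e A C hAadd hAsmul hAbdd P (hd P hwP)
  obtain ⟨iM, rM⟩ := aux_repr e A C hAadd hAsmul hAbdd M (hd M hwM)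
  obtain ⟨q1, hq1, e1⟩ := aux_pos_measure (auxQ S N) hQc hQ (hQS 0 hS0) P _ (aux_w_pos e p)
    (aux_w_meas e p) hwP _ iP (fun z => hQS _ (hSψ z))
  obtain ⟨q2, hq2, e2⟩ := aux_pos_measure (auxQ S N) hQc hQ (hQS 0 hS0) M _ (aux_w_pos e p)
    (aux_w_meas e p) hwM _ iM (fun z => hQS _ (hSψ z))
  have hAμ : A μ = A P.toSignedMeasure - A M.toSignedMeasure := by
    let L : SignedMeasure Z →ₗ[ℝ] E := ⟨⟨A, hAadd⟩, hAsmul⟩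
    have h1 : μ = P.toSignedMeasure - M.toSignedMeasure :=
      (SignedMeasure.toSignedMeasure_toJordanDecomposition μ).symm
    have h2 : L (P.toSignedMeasure - M.toSignedMeasure) = L P.toSignedMeasure - L M.toSignedMeasure :=
      map_sub L _ _
    rw [← h1] at h2
    exact h2
  rw [rP, rM, e1, e2] at hAμ
  rw [hmom]
  set a := ∫ z, (1 + dist z e ^ p) ∂P
  set b := ∫ z, (1 + dist z e ^ p) ∂M
  have ha : 0 ≤ a := integral_nonneg fun z => (aux_w_pos e p z).le
  have hb : 0 ≤ b := integral_nonneg fun z => (aux_w_pos e p z).le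
  rcases (add_nonneg ha hb).eq_or_lt with h | h
  · have ha0 : a = 0 := by linarith
    have hb0 : b = 0 := by linarith
    refine ⟨0, 0, by simp, by simpa using fun _ => hS0, by simp [ha0, hb0], ?_⟩
    rw [hAμ, ha0, hb0]; simp
  · obtain ⟨c, v, h1, h2, h3, h4⟩ := hQ hq1 (hQn _ hq2) (a := a / (a + b)) (b := b / (a + b))
      (by positivity) (by positivity) (by field_simp)
    refine ⟨fun i => (a + b) * c i, v, fun i => mul_nonneg h.le (h1 i), h2, ?_, ?_⟩
    · rw [← Finset.mul_sum]; nlinarith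
    · simp_rw [mul_smul]
      rw [← Finset.smul_sum, h4, hAμ, smul_add, smul_smul, smul_smul,
        mul_div_cancel₀ _ h.ne', mul_div_cancel₀ _ h.ne', smul_neg, sub_eq_add_neg]

lemma aux_tv_sum {ι : Type*} (s : Finset ι) (μ : ι → SignedMeasure Z) :
    (∑ i ∈ s, μ i).totalVariation ≤ ∑ i ∈ s, (μ i).totalVariation := by
  induction s using Finset.induction_on with
  | empty => simp [SignedMeasure.totalVariation_zero]
  | insert a s ha ih =>
    rw [Finset.sum_insert ha, Finset.sum_insert ha]
    refine le_trans ?_ (add_le_add le_rfl ih)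
    simp only [SignedMeasure.totalVariation_eq_variation]
    exact VectorMeasure.variation_add_le

lemma aux_mom_sum (e : Z) (p : ℝ) (N : ℕ) (c : Fin N → ℝ) (z : Fin N → Z) :
    momLint e p (∑ i, (c i * (1 + dist (z i) e ^ p)⁻¹) • diracSM (z i))
      ≤ ENNReal.ofReal (∑ i, |c i|) := by
  unfold momLint
  refine (lintegral_mono' (aux_tv_sum _ _) le_rfl).trans ?_
  rw [lintegral_finsetSum_measure, ENNReal.ofReal_sum_of_nonneg (fun i _ => abs_nonneg _)]
  refine Finset.sum_le_sum fun i _ => ?_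
  rw [SignedMeasure.totalVariation_eq_variation, VectorMeasure.variation_smul, diracSM,
    Measure.variation_toSignedMeasure, lintegral_smul_measure,
    lintegral_dirac' _ (aux_w_meas e p).ennreal_ofReal]
  have hw := aux_w_pos e p (z i)
  have h1 : (‖c i * (1 + dist (z i) e ^ p)⁻¹‖₊ : ℝ≥0∞)
      = ENNReal.ofReal (|c i| * (1 + dist (z i) e ^ p)⁻¹) := by
    rw [← enorm_eq_nnnorm, ← ofReal_norm, Real.norm_eq_abs, abs_mul, abs_of_pos (inv_pos.2 hw)]
  rw [ENNReal.smul_def, h1, smul_eq_mul, ← ENNReal.ofReal_mul (by positivity), mul_assoc,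
    inv_mul_cancel₀ hw.ne', mul_one]

lemma aux_compact [ProperSpace Z] {E : Type*} [NormedAddCommGroup E] [NormedSpace ℝ E]
    (e : Z) (p : ℝ) (hp : 1 < p) (φ : Z → E) (K : ℝ) (hφ : ∀ x y, ‖φ x - φ y‖ ≤ K * dist x y) :
    IsCompact (insert 0 (Set.range fun z => (1 + dist z e ^ p)⁻¹ • φ z)) := by
  have hLip : LipschitzWith (Real.toNNReal K) φ := by
    refine LipschitzWith.of_dist_le_mul fun x y => ?_
    rw [dist_eq_norm]
    refine (hφ x y).trans ?_
    gcongr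
    exact Real.le_coe_toNNReal K
  have hcont : Continuous fun z : Z => (1 + dist z e ^ p)⁻¹ • φ z := by
    refine Continuous.smul (Continuous.inv₀ ?_ fun z => (aux_w_pos e p z).ne') hLip.continuous
    refine continuous_const.add (Continuous.rpow_const (by fun_prop) fun z => Or.inr (by linarith))
  refine Filter.Tendsto.isCompact_insert_range_of_cocompact ?_ hcont
  have hd : Tendsto (fun z : Z => dist z e) (cocompact Z) atTop := tendsto_dist_right_cocompact_atTop e
  have hlim : Tendsto (fun z : Z => (‖φ e‖ + |K|) * dist z e ^ (-(p - 1))) (cocompact Z) (𝓝 0) := by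
    have := ((tendsto_rpow_neg_atTop (sub_pos.2 hp)).comp hd).const_mul (‖φ e‖ + |K|)
    simpa using this
  refine squeeze_zero_norm' ?_ hlim
  filter_upwards [hd.eventually_ge_atTop 1] with z hz
  have hw := aux_w_pos e p z
  have h0 : 0 < dist z e := by linarith
  rw [norm_smul, Real.norm_of_nonneg (inv_pos.2 hw).le]
  have h1 : ‖φ z‖ ≤ (‖φ e‖ + |K|) * dist z e := by
    have a1 := norm_le_insert' (φ z) (φ e)
    have a2 := hφ z e
    have a3 : K * dist z e ≤ |K| * dist z e := by gcongr; exact le_abs_self K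
    have a4 : ‖φ e‖ * 1 ≤ ‖φ e‖ * dist z e := by gcongr
    linarith
  have h2 : (1 + dist z e ^ p)⁻¹ ≤ dist z e ^ (-p) := by
    rw [Real.rpow_neg h0.le]
    have : 0 < dist z e ^ p := Real.rpow_pos_of_pos h0 p
    gcongr
    linarith
  calc (1 + dist z e ^ p)⁻¹ * ‖φ z‖ ≤ dist z e ^ (-p) * ((‖φ e‖ + |K|) * dist z e) := by
        gcongr
    _ = (‖φ e‖ + |K|) * (dist z e ^ (-p) * dist z e ^ (1 : ℝ)) := by rw [Real.rpow_one]; ring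
    _ = _ := by rw [← Real.rpow_add h0]; congr 2; ring

lemma aux_bddBelow {N : ℕ} (F : EuclideanSpace ℝ (Fin N) → EReal)
    (hFnebot : ∀ x, F x ≠ ⊥)
    (hFcoercive : ∀ c : ℝ, ∃ R : ℝ, ∀ x : EuclideanSpace ℝ (Fin N),
      R ≤ ‖x‖ → (c : EReal) ≤ F x)
    (hFlsc : LowerSemicontinuous F) : ∃ b : ℝ, ∀ x, (b : EReal) ≤ F x := by
  obtain ⟨R, hR⟩ := hFcoercive 0
  obtain ⟨x1, _, h1⟩ := LowerSemicontinuousOn.exists_isMinOn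
    (s := Metric.closedBall (0 : EuclideanSpace ℝ (Fin N)) (max R 0))
    ⟨0, by simp⟩ (isCompact_closedBall _ _) (hFlsc.lowerSemicontinuousOn _)
  have key : ∃ r : ℝ, (r : EReal) ≤ F x1 := by
    induction h : F x1 using EReal.rec with
    | bot => exact absurd h (hFnebot x1)
    | coe r => exact ⟨r, le_rfl⟩
    | top => exact ⟨0, le_top⟩
  obtain ⟨r, hr⟩ := key
  refine ⟨min r 0, fun x => ?_⟩
  rcases le_or_gt R ‖x‖ with h | h
  · exact le_trans (EReal.coe_le_coe_iff.2 (min_le_right _ _)) (hR x h)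
  · refine le_trans (EReal.coe_le_coe_iff.2 (min_le_left _ _)) (hr.trans (h1 ?_))
    rw [mem_closedBall_zero_iff]
    exact h.le.trans (le_max_left _ _)

/-- (Representer theorem, `α = 0`.) Suppose `H = ℝ^N`, `p > 1` and
`α = 0`.  Then the problem `inf_{μ ∈ KRu(Z)} F(Aμ) + G_{0,β}(μ)` has a minimizer
`μ_min ∈ M_p(Z)` of the form `μ_min = ∑_{i=1}^N c_i (1 + d(z_i,e)^p)⁻¹ δ_{z_i}`. -/
theorem representer_theorem_tv [LocallyCompactSpace Z] [CompleteSpace Z]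
    [TopologicalSpace.SeparableSpace Z] (hgeo : IsGeodesic Z) (e : Z)
    (p β : ℝ) (hp : 1 < p) (hβ : 0 < β) (N : ℕ)
    (A : SignedMeasure Z → EuclideanSpace ℝ (Fin N))
    (hAadd : ∀ μ ν : SignedMeasure Z, A (μ + ν) = A μ + A ν)
    (hAsmul : ∀ (c : ℝ) (μ : SignedMeasure Z), A (c • μ) = c • A μ)
    (hAbdd : ∃ C : ℝ, ∀ μ : SignedMeasure Z, MemM1 e μ → ‖A μ‖ ≤ C * kruNorm e μ)
    (F : EuclideanSpace ℝ (Fin N) → EReal)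
    (hFnebot : ∀ x, F x ≠ ⊥) (hFproper : ∃ x, F x ≠ ⊤)
    (hFconvex : ∀ x y : EuclideanSpace ℝ (Fin N), ∀ a b : ℝ, 0 ≤ a → 0 ≤ b → a + b = 1 →
      F (a • x + b • y) ≤ (a : EReal) * F x + (b : EReal) * F y)
    (hFcoercive : ∀ c : ℝ, ∃ R : ℝ, ∀ x : EuclideanSpace ℝ (Fin N),
      R ≤ ‖x‖ → (c : EReal) ≤ F x)
    (hFlsc : LowerSemicontinuous F) :
    ∃ μmin : SignedMeasure Z, MemMp e p μmin ∧
      (∀ μ : SignedMeasure Z,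
        F (A μmin) + Gab e p 0 β μmin ≤ F (A μ) + Gab e p 0 β μ) ∧
      ∃ (c : Fin N → ℝ) (z : Fin N → Z),
        μmin = ∑ i, (c i * (1 + dist (z i) e ^ p)⁻¹) • diracSM (z i) := by
  obtain ⟨C, hC⟩ := hAbdd
  have hproper : ProperSpace Z := aux_proper hgeo
  let L : SignedMeasure Z →ₗ[ℝ] EuclideanSpace ℝ (Fin N) := ⟨⟨A, hAadd⟩, hAsmul⟩
  have hAsub : ∀ μ ν : SignedMeasure Z, A (μ - ν) = A μ - A ν := fun μ ν => L.map_sub μ ν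
  have hN : Module.finrank ℝ (EuclideanSpace ℝ (Fin N)) = N := by simp
  have hGtop : ∀ μ, ¬ MemMp e p μ → F (A μ) + Gab e p 0 β μ = ⊤ := fun μ h => by
    rw [Gab, if_neg h]; exact EReal.add_top_of_ne_bot (hFnebot _)
  have hG : ∀ μ, MemMp e p μ → Gab e p 0 β μ = ((β * (momLint e p μ).toReal : ℝ) : EReal) :=
    fun μ h => by rw [Gab, if_pos h]; simp
  by_cases hall : ∀ μ, MemMp e p μ → F (A μ) = ⊤
  · refine ⟨0, ?_, ?_, 0, fun _ => e, by simp⟩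
    · simp [MemMp, SignedMeasure.totalVariation_zero]
    · intro μ
      by_cases h : MemMp e p μ
      · rw [hall μ h, hG μ h]
        rw [EReal.top_add_coe]; exact le_top
      · rw [hGtop μ h]; exact le_top
  push Not at hall
  obtain ⟨μ0, hμ0, hF0⟩ := hall
  obtain ⟨b, hb⟩ := aux_bddBelow F hFnebot hFcoercive hFlsc
  obtain ⟨r0, hr0⟩ : ∃ r : ℝ, F (A μ0) = r := ⟨(F (A μ0)).toReal, (EReal.coe_toReal hF0 (hFnebot _)).symm⟩
  set S0 := insert 0 (Set.range fun z => (1 + dist z e ^ p)⁻¹ • A (diracSM z)) with hS0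
  have hS0c : IsCompact S0 := aux_compact e p hp (fun z => A (diracSM z)) |C|
    (aux_dirac_lip e A C hAsub hC)
  set S := S0 ∪ (Set.image Neg.neg S0) with hS
  have hSc : IsCompact S := hS0c.union (hS0c.image continuous_neg)
  have hSzero : (0 : EuclideanSpace ℝ (Fin N)) ∈ S := Or.inl (Set.mem_insert _ _)
  have hSneg : ∀ x ∈ S, -x ∈ S := by
    rintro x (h | ⟨y, hy, rfl⟩)
    · exact Or.inr ⟨x, h, rfl⟩
    · rw [neg_neg]; exact Or.inl hy
  have hSrep : ∀ x ∈ S, ∃ (k : ℝ) (z : Z), |k| ≤ 1 ∧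
      x = k • ((1 + dist z e ^ p)⁻¹ • A (diracSM z)) := by
    have h0 : ∀ x ∈ S0, ∃ (k : ℝ) (z : Z), |k| ≤ 1 ∧
        x = k • ((1 + dist z e ^ p)⁻¹ • A (diracSM z)) := by
      rintro x (rfl | ⟨z, rfl⟩)
      · exact ⟨0, e, by simp, by simp⟩
      · exact ⟨1, z, by simp, by simp⟩
    rintro x (h | ⟨y, hy, rfl⟩)
    · exact h0 x h
    · obtain ⟨k, z, hk, hy⟩ := h0 y hy
      exact ⟨-k, z, by simpa using hk, by rw [hy, neg_smul]⟩
  have hdec := aux_decomp N hN e p hp A C hAadd hAsmul hC S hSc hSzero hSneg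
    (fun z => Or.inl (Or.inr ⟨z, rfl⟩))
  set m0 := (momLint e p μ0).toReal with hm0
  set V0 := r0 + β * m0 with hV0
  set M := (V0 - b) / β with hM
  have hbr : b ≤ r0 := by
    have := hb (A μ0); rw [hr0] at this; exact EReal.coe_le_coe_iff.1 this
  have hβM : b + β * M = V0 := by rw [hM]; field_simp; ring
  have hm0M : m0 ≤ M := by
    rw [hM, le_div_iff₀ hβ, hV0]; linarith
  let T : Set ((Fin N → ℝ) × (Fin N → EuclideanSpace ℝ (Fin N))) :=
    (Set.univ.pi fun _ => Set.Icc 0 M) ×ˢ (Set.univ.pi fun _ => S)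
  have hT : IsCompact T := (isCompact_univ_pi fun _ => isCompact_Icc).prod
    (isCompact_univ_pi fun _ => hSc)
  have hmemT : ∀ (c : Fin N → ℝ) (v : Fin N → EuclideanSpace ℝ (Fin N)), (∀ i, 0 ≤ c i) →
      (∀ i, v i ∈ S) → ∑ i, c i ≤ M → (c, v) ∈ T := fun c v h1 h2 h3 =>
    ⟨fun i _ => ⟨h1 i, (Finset.single_le_sum (fun j _ => h1 j) (Finset.mem_univ i)).trans h3⟩,
      fun i _ => h2 i⟩
  let H : (Fin N → ℝ) × (Fin N → EuclideanSpace ℝ (Fin N)) → EReal := fun q =>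
    F (∑ i, q.1 i • q.2 i) + ((β * ∑ i, q.1 i : ℝ) : EReal)
  have hH : LowerSemicontinuous H := by
    refine LowerSemicontinuous.add' ?_ ?_ ?_
    · exact hFlsc.comp (g := fun q : (Fin N → ℝ) × (Fin N → EuclideanSpace ℝ (Fin N)) =>
        ∑ i, q.1 i • q.2 i) (by fun_prop)
    · refine Continuous.lowerSemicontinuous (continuous_coe_real_ereal.comp ?_)
      fun_prop
    · intro q
      exact EReal.continuousAt_add (Or.inr (EReal.coe_ne_bot _)) (Or.inr (EReal.coe_ne_top _))
  -- every competitor of small moment is dominated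
  have hcomp : ∀ μ, MemMp e p μ → (momLint e p μ).toReal ≤ M →
      ∃ q ∈ T, H q ≤ F (A μ) + ((β * (momLint e p μ).toReal : ℝ) : EReal) := by
    intro μ hμ hle
    obtain ⟨c, v, h1, h2, h3, h4⟩ := hdec μ hμ
    refine ⟨(c, v), hmemT c v h1 h2 (h3.trans hle), ?_⟩
    change F (∑ i, c i • v i) + ((β * ∑ i, c i : ℝ) : EReal) ≤ _
    rw [h4]
    refine add_le_add le_rfl (EReal.coe_le_coe_iff.2 ?_)
    gcongr
  obtain ⟨q0, hq0, hHq0⟩ := hcomp μ0 hμ0 hm0M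
  obtain ⟨⟨c, v⟩, hcvT, hmin⟩ := LowerSemicontinuousOn.exists_isMinOn ⟨q0, hq0⟩ hT
    (hH.lowerSemicontinuousOn T)
  have hle : ∀ μ, H (c, v) ≤ F (A μ) + Gab e p 0 β μ := by
    intro μ
    by_cases h : MemMp e p μ
    · rw [hG μ h]
      rcases le_total (momLint e p μ).toReal M with hM' | hM'
      · obtain ⟨q, hq, hqH⟩ := hcomp μ h hM'
        exact (hmin hq).trans hqH
      · refine (hmin hq0).trans (hHq0.trans ?_)
        rw [hr0, ← EReal.coe_add]
        change ((V0 : ℝ) : EReal) ≤ _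
        rw [← hβM, EReal.coe_add]
        refine add_le_add (hb _) (EReal.coe_le_coe_iff.2 ?_)
        gcongr
    · rw [hGtop μ h]; exact le_top
  choose k z hk hkz using fun i => hSrep (v i) (hcvT.2 i trivial)
  have hc0 : ∀ i, 0 ≤ c i := fun i => (hcvT.1 i trivial).1
  have hmom := aux_mom_sum e p N (fun i => c i * k i) z
  set μm : SignedMeasure Z := ∑ i, (c i * k i * (1 + dist (z i) e ^ p)⁻¹) • diracSM (z i) with hμm
  have hMp : MemMp e p μm := by
    refine lt_of_le_of_lt (lintegral_mono fun x => ?_) (hmom.trans_lt ENNReal.ofReal_lt_top)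
    exact ENNReal.ofReal_le_ofReal (by linarith)
  refine ⟨μm, hMp, fun μ => le_trans ?_ (hle μ), fun i => c i * k i, z, rfl⟩
  have hAm : A μm = ∑ i, c i • v i := by
    change L μm = _
    rw [hμm, map_sum]
    refine Finset.sum_congr rfl fun i _ => ?_
    rw [map_smul]
    change _ • A (diracSM (z i)) = _
    conv_rhs => rw [hkz i]
    rw [smul_smul, smul_smul, mul_assoc]
  rw [hG _ hMp, hAm]
  change _ ≤ F (∑ i, c i • v i) + ((β * ∑ i, c i : ℝ) : EReal)
  refine add_le_add le_rfl (EReal.coe_le_coe_iff.2 ?_)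
  have h1 : (momLint e p μm).toReal ≤ ∑ i, |c i * k i| := by
    have := ENNReal.toReal_mono ENNReal.ofReal_ne_top hmom
    rwa [ENNReal.toReal_ofReal (Finset.sum_nonneg fun i _ => abs_nonneg _)] at this
  have h2 : ∑ i, |c i * k i| ≤ ∑ i, c i := by
    refine Finset.sum_le_sum fun i _ => ?_
    rw [abs_mul, abs_of_nonneg (hc0 i)]
    exact mul_le_of_le_one_right (hc0 i) (hk i)
  exact mul_le_mul_of_nonneg_left (h1.trans h2) hβ.le
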